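/- arXiv:2406.12500 — 2 statements merged into one kernel-verified Lean document; each statement's English description precedes it below -/
import Mathlib

section
/- Let K ∈ (0,1) and m ≥ 1 be an integer. Let s : ℝ^m → ℝ be a C¹ function with ‖Ds(y)‖ ≤ K for all y ∈ ℝ^m, and let γ = (γ₁, γ₂) : [0,1] → ℝ × ℝ^m be a C¹ curve with γ₁(0) = s(γ₂(0)) and γ₁(1) = s(γ₂(1)). Then there exists t ∈ [0,1] such that |γ₁'(t)| ≤ K ‖γ₂'(t)‖. -/
open Set

/-- A C¹ curve whose endpoints lie on the graph of a `K`-Lipschitz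
function `s : ℝ^m → ℝ` must, at some parameter `t ∈ [0,1]`, have its first-coordinate
velocity bounded by `K` times the norm of its second-coordinate velocity. -/
theorem statement7 (K : ℝ) (hK0 : 0 < K) (hK1 : K < 1) (m : ℕ) (hm : 1 ≤ m)
    (s : EuclideanSpace ℝ (Fin m) → ℝ) (hs : ContDiff ℝ 1 s)
    (hsK : ∀ y, ‖fderiv ℝ s y‖ ≤ K)
    (γ : ℝ → ℝ × EuclideanSpace ℝ (Fin m))
    (hγ : ContDiffOn ℝ 1 γ (Icc 0 1))
    (h0 : (γ 0).1 = s (γ 0).2) (h1 : (γ 1).1 = s (γ 1).2) :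
    ∃ t ∈ Icc (0:ℝ) 1,
      |(derivWithin γ (Icc 0 1) t).1| ≤ K * ‖(derivWithin γ (Icc 0 1) t).2‖ := by
  have hd : ∀ t ∈ Ioo (0:ℝ) 1, HasDerivAt γ (derivWithin γ (Icc 0 1) t) t := by
    intro t ht
    have h := (hγ.differentiableOn one_ne_zero t (Ioo_subset_Icc_self ht)).hasDerivWithinAt
    exact h.hasDerivAt (Icc_mem_nhds ht.1 ht.2)
  have hc : ContinuousOn (fun t => (γ t).1 - s (γ t).2) (Icc 0 1) :=
    (continuous_fst.comp_continuousOn hγ.continuousOn).sub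
      (hs.continuous.comp_continuousOn (continuous_snd.comp_continuousOn hγ.continuousOn))
  obtain ⟨t, ht, hz⟩ := exists_hasDerivAt_eq_zero
    (f := fun t => (γ t).1 - s (γ t).2)
    (f' := fun t => (derivWithin γ (Icc 0 1) t).1
      - fderiv ℝ s (γ t).2 (derivWithin γ (Icc 0 1) t).2)
    zero_lt_one hc (by simp [h0, h1]) (by
      intro t ht
      have h := hd t ht
      have hfst : HasDerivAt (fun t => (γ t).1) (derivWithin γ (Icc 0 1) t).1 t :=
        (ContinuousLinearMap.fst ℝ ℝ (EuclideanSpace ℝ (Fin m))).hasFDerivAt.comp_hasDerivAt t h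
      have hsnd : HasDerivAt (fun t => (γ t).2) (derivWithin γ (Icc 0 1) t).2 t :=
        (ContinuousLinearMap.snd ℝ ℝ (EuclideanSpace ℝ (Fin m))).hasFDerivAt.comp_hasDerivAt t h
      have hsd := (hs.differentiable one_ne_zero (γ t).2).hasFDerivAt
      exact hfst.sub (hsd.comp_hasDerivAt t hsnd))
  refine ⟨t, Ioo_subset_Icc_self ht, ?_⟩
  rw [sub_eq_zero.mp hz, ← Real.norm_eq_abs]
  exact (fderiv ℝ s (γ t).2).le_of_opNorm_le (hsK _) _
end

section
/- For every α ∈ (0, 1/20) and every x_B ∈ (0, 1], there exist an integer m ≥ 1 and, setting N := 8m + 1, an integer n with 0 < n < (N − 1)/2, such that, with x_C := x_B·(N − 2n)/N, the following hold: (i) N ≥ ⌊1/α⌋ + 2; (ii) α·(x_B − x_C) < 2x_B/N < α·(x_B + x_C); (iii) x_C + α·x_B < x_B (so that a real x_G with x_C + α·x_B < x_G < x_B exists); moreover one can achieve x_C/x_B ∈ (1/9, 1/4) and 8/(5α) < N < 9/(4α). -/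
open Set

/-- Arithmetic choice of the grid size `N = 8m+1`, the center index
`n` and the center half-width `x_C = x_B (N - 2n)/N` for a nearly-affine blender
system with central contraction rate `α < 1/20`. -/
theorem statement18 (α xB : ℝ) (hα0 : 0 < α) (hα : α < 1/20) (hxB0 : 0 < xB)
    (hxB : xB ≤ 1) :
    ∃ m : ℕ, 1 ≤ m ∧ ∃ n : ℕ, 0 < n ∧ (n : ℝ) < ((8*(m:ℝ)+1) - 1)/2 ∧
      (Nat.floor (1/α) + 2 ≤ 8*m+1) ∧
      (α * (xB - xB * ((8*(m:ℝ)+1) - 2*(n:ℝ))/(8*(m:ℝ)+1)) < 2*xB/(8*(m:ℝ)+1)) ∧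
      (2*xB/(8*(m:ℝ)+1) < α * (xB + xB * ((8*(m:ℝ)+1) - 2*(n:ℝ))/(8*(m:ℝ)+1))) ∧
      (xB * ((8*(m:ℝ)+1) - 2*(n:ℝ))/(8*(m:ℝ)+1) + α * xB < xB) ∧
      (1/9 < ((8*(m:ℝ)+1) - 2*(n:ℝ))/(8*(m:ℝ)+1)) ∧
      (((8*(m:ℝ)+1) - 2*(n:ℝ))/(8*(m:ℝ)+1) < 1/4) ∧
      (8/(5*α) < 8*(m:ℝ)+1) ∧ (8*(m:ℝ)+1 < 9/(4*α)) := by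
  obtain ⟨A, hA⟩ : ∃ A : ℝ, A = 1/α := ⟨_, rfl⟩
  have hAα : α * A = 1 := by rw [hA]; field_simp
  have hA20 : 20 < A := by
    rw [hA, lt_div_iff₀ hα0]; linarith
  have h1 := Nat.floor_le (show (0:ℝ) ≤ A/5 by linarith)
  have h2 := Nat.lt_floor_add_one (A/5)
  obtain ⟨m, hm⟩ : ∃ m : ℕ, m = Nat.floor (A/5) + 1 := ⟨_, rfl⟩
  have hmR : (m:ℝ) = (Nat.floor (A/5) : ℝ) + 1 := by rw [hm]; push_cast; ring
  have hlo : A < 5 * m := by linarith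
  have hhi : (m:ℝ) ≤ A/5 + 1 := by linarith
  have hm4 : (4:ℝ) < m := by linarith
  have hm4' : 4 < m := by exact_mod_cast hm4
  have hN : (0:ℝ) < 8*(m:ℝ)+1 := by linarith
  have hr1 : ((8*(m:ℝ)+1) - 2*((3*m+1 : ℕ):ℝ))/(8*(m:ℝ)+1) < 1/4 := by
    rw [div_lt_iff₀ hN]; push_cast; linarith
  refine ⟨m, by omega, 3*m+1, by omega, ?_, ?_, ?_, ?_, ?_, ?_, hr1, ?_, ?_⟩
  · push_cast; linarith
  · rw [← hA]
    have h3 := Nat.floor_le (show (0:ℝ) ≤ A by linarith)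
    have h4 : ((Nat.floor A : ℕ) : ℝ) < ((5*m : ℕ) : ℝ) := by push_cast; linarith
    have h5 : Nat.floor A < 5*m := by exact_mod_cast h4
    omega
  · have e : α * (xB - xB * ((8*(m:ℝ)+1) - 2*((3*m+1 : ℕ):ℝ))/(8*(m:ℝ)+1))
        = (2 * xB * (α * (3*m+1))) / (8*(m:ℝ)+1) := by
      push_cast; field_simp; ring
    rw [e]
    apply div_lt_div_of_pos_right _ hN
    have : α * (3*m+1) < α * A := mul_lt_mul_of_pos_left (by linarith) hα0
    nlinarith
  · have e : α * (xB + xB * ((8*(m:ℝ)+1) - 2*((3*m+1 : ℕ):ℝ))/(8*(m:ℝ)+1))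
        = (2 * xB * (α * (5*m))) / (8*(m:ℝ)+1) := by
      push_cast; field_simp; ring
    rw [e]
    apply div_lt_div_of_pos_right _ hN
    have : α * A < α * (5*m) := mul_lt_mul_of_pos_left (by linarith) hα0
    nlinarith
  · rw [mul_div_assoc]
    nlinarith
  · rw [lt_div_iff₀ hN]; push_cast; linarith
  · have e : 8/(5*α) = 8/5*A := by rw [hA]; field_simp
    rw [e]; linarith
  · have e : 9/(4*α) = 9/4*A := by rw [hA]; field_simp
    rw [e]; linarith
end
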